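/- arXiv:2409.17843 — 4 statements merged into one kernel-verified Lean document; each statement's English description precedes it below -/
import Mathlib

section
/- Let a < b be reals and α, β, σ > 0. Let μ_H be the uniform probability measure on [a, b] and let μ_G be the measure on ℝ with density g ↦ (g/σ²)·exp(−g²/(2σ²)) on [0, ∞) (and 0 on (−∞, 0)) with respect to Lebesgue measure. Then for every v ≥ αb, the product measure of the set {(h, g) : α·h + β·g ≤ v} equals 1 + (β·σ/((b−a)·α))·√(π/2)·[erf((v − αb)/(√2·β·σ)) − erf((v − αa)/(√2·β·σ))]. -/
open Real MeasureTheory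

/-- The Gauss error function `erf x = (2/√π) ∫₀ˣ exp (-t²) dt`. -/
noncomputable def erf (x : ℝ) : ℝ :=
  (2 / Real.sqrt Real.pi) * ∫ t in (0 : ℝ)..x, Real.exp (-t ^ 2)

theorem integral_exp_neg_sq_eq_erf_sub (x y : ℝ) :
    ∫ t in x..y, Real.exp (-t ^ 2) = Real.sqrt Real.pi / 2 * (erf y - erf x) := by
  have hi : ∀ c d : ℝ, IntervalIntegrable (fun t : ℝ => Real.exp (-t ^ 2)) volume c d :=
    fun c d => Continuous.intervalIntegrable (by fun_prop) c d
  have hpi : Real.sqrt Real.pi ≠ 0 := (Real.sqrt_pos.2 Real.pi_pos).ne'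
  rw [← intervalIntegral.integral_interval_sub_left (hi 0 y) (hi 0 x)]
  unfold erf
  field_simp

theorem integral_rayleigh_density (σ x : ℝ) (hσ : 0 < σ) :
    ∫ g in (0 : ℝ)..x, g / σ ^ 2 * Real.exp (-g ^ 2 / (2 * σ ^ 2)) =
      1 - Real.exp (-x ^ 2 / (2 * σ ^ 2)) := by
  have hd : ∀ g : ℝ, HasDerivAt (fun g : ℝ => -Real.exp (-g ^ 2 / (2 * σ ^ 2)))
      (g / σ ^ 2 * Real.exp (-g ^ 2 / (2 * σ ^ 2))) g := by
    intro g
    refine (((hasDerivAt_pow 2 g).fun_neg.div_const (2 * σ ^ 2)).exp.fun_neg).congr_deriv ?_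
    simp
    field_simp
  rw [intervalIntegral.integral_eq_sub_of_hasDerivAt (fun g _ => hd g)
    (Continuous.intervalIntegrable (by fun_prop) 0 x)]
  simp
  ring

theorem rayleigh_measure_Iic (σ x : ℝ) (hσ : 0 < σ) (hx : 0 ≤ x) :
    (volume.withDensity fun g : ℝ =>
      ENNReal.ofReal (if 0 ≤ g then g / σ ^ 2 * Real.exp (-g ^ 2 / (2 * σ ^ 2)) else 0))
      (Set.Iic x) = ENNReal.ofReal (1 - Real.exp (-x ^ 2 / (2 * σ ^ 2))) := by
  have hind : (Set.Iic x).indicator (fun g : ℝ =>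
      ENNReal.ofReal (if 0 ≤ g then g / σ ^ 2 * Real.exp (-g ^ 2 / (2 * σ ^ 2)) else 0)) =
      (Set.Icc 0 x).indicator (fun g : ℝ =>
        ENNReal.ofReal (g / σ ^ 2 * Real.exp (-g ^ 2 / (2 * σ ^ 2)))) := by
    ext g
    by_cases h0 : 0 ≤ g <;> by_cases h1 : g ≤ x <;> simp [Set.indicator, h0, h1]
  rw [withDensity_apply _ measurableSet_Iic, ← lintegral_indicator measurableSet_Iic, hind,
    lintegral_indicator measurableSet_Icc, ← ofReal_integral_eq_lintegral_ofReal,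
    integral_Icc_eq_integral_Ioc, ← intervalIntegral.integral_of_le hx,
    integral_rayleigh_density σ x hσ]
  · exact Continuous.integrableOn_Icc (by fun_prop)
  · filter_upwards [ae_restrict_mem measurableSet_Icc] with g hg
    have := hg.1
    simp only [Pi.zero_apply]
    positivity

theorem integral_rayleigh_cdf_affine (a b α β σ v : ℝ) (hα : 0 < α) (hβ : 0 < β) (hσ : 0 < σ) :
    ∫ h in a..b, (1 - Real.exp (-((v - α * h) / β) ^ 2 / (2 * σ ^ 2))) =
      (b - a) + β * σ / α * Real.sqrt (Real.pi / 2) *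
        (erf ((v - α * b) / (Real.sqrt 2 * β * σ)) -
          erf ((v - α * a) / (Real.sqrt 2 * β * σ))) := by
  have hsq : Real.sqrt 2 ^ 2 = 2 := Real.sq_sqrt (by norm_num)
  have hc : α / (Real.sqrt 2 * β * σ) ≠ 0 := by positivity
  have hexp : ∀ h : ℝ, Real.exp (-((v - α * h) / β) ^ 2 / (2 * σ ^ 2)) =
      Real.exp (-(v / (Real.sqrt 2 * β * σ) - α / (Real.sqrt 2 * β * σ) * h) ^ 2) := by
    intro h
    congr 1
    rw [div_mul_eq_mul_div, ← sub_div, div_pow, div_pow, mul_pow, mul_pow, hsq]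
    field_simp
  rw [intervalIntegral.integral_sub (by simp) (Continuous.intervalIntegrable (by fun_prop) a b)]
  simp_rw [hexp]
  rw [intervalIntegral.integral_comp_sub_mul (fun t : ℝ => Real.exp (-t ^ 2)) hc,
    integral_exp_neg_sq_eq_erf_sub, div_mul_eq_mul_div _ _ a, div_mul_eq_mul_div _ _ b, ← sub_div,
    ← sub_div, Real.sqrt_div Real.pi_pos.le]
  simp only [intervalIntegral.integral_const, smul_eq_mul, mul_one, inv_div]
  field_simp
  linear_combination (-(β * σ * Real.sqrt Real.pi *
    (erf ((v - a * α) / (Real.sqrt 2 * β * σ)) - erf ((v - b * α) / (Real.sqrt 2 * β * σ))))) * hsq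

/-- The CDF of `α·V^H + β·V^G`, where `V^H` is uniform on `[a,b]` and `V^G` is
Rayleigh with scale `σ`, independent: for every `v ≥ α·b`, the product measure of
`{(h,g) : α·h + β·g ≤ v}` equals
`1 + (βσ/((b-a)α))·√(π/2)·[erf((v-αb)/(√2 βσ)) - erf((v-αa)/(√2 βσ))]`. -/
theorem valuation_cdf (a b α β σ : ℝ) (hab : a < b) (hα : 0 < α) (hβ : 0 < β)
    (hσ : 0 < σ)
    (μH μG : Measure ℝ)
    (hμH : μH = (ENNReal.ofReal (b - a))⁻¹ • volume.restrict (Set.Icc a b))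
    (hμG : μG = volume.withDensity fun g =>
      ENNReal.ofReal (if 0 ≤ g then g / σ ^ 2 * Real.exp (-g ^ 2 / (2 * σ ^ 2)) else 0)) :
    ∀ v : ℝ, α * b ≤ v →
      (μH.prod μG) {p : ℝ × ℝ | α * p.1 + β * p.2 ≤ v} =
        ENNReal.ofReal (1 + β * σ / ((b - a) * α) * Real.sqrt (Real.pi / 2) *
          (erf ((v - α * b) / (Real.sqrt 2 * β * σ)) -
            erf ((v - α * a) / (Real.sqrt 2 * β * σ)))) := by
  intro v hv
  subst hμH hμG
  have hba : 0 < b - a := sub_pos.2 hab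
  have hmeas : MeasurableSet {p : ℝ × ℝ | α * p.1 + β * p.2 ≤ v} :=
    measurableSet_le (by fun_prop) measurable_const
  have hsection : ∀ h : ℝ, Prod.mk h ⁻¹' {p : ℝ × ℝ | α * p.1 + β * p.2 ≤ v} =
      Set.Iic ((v - α * h) / β) := by
    intro h
    ext g
    simp only [Set.mem_preimage, Set.mem_ofPred_eq, Set.mem_Iic]
    rw [le_div_iff₀ hβ, le_sub_iff_add_le, add_comm, mul_comm g]
  have hcdf : ∀ h ∈ Set.Icc a b, (volume.withDensity fun g : ℝ =>
      ENNReal.ofReal (if 0 ≤ g then g / σ ^ 2 * Real.exp (-g ^ 2 / (2 * σ ^ 2)) else 0))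
      (Set.Iic ((v - α * h) / β)) =
        ENNReal.ofReal (1 - Real.exp (-((v - α * h) / β) ^ 2 / (2 * σ ^ 2))) := by
    intro h hh
    refine rayleigh_measure_Iic σ _ hσ (div_nonneg (sub_nonneg.2 ?_) hβ.le)
    exact (mul_le_mul_of_nonneg_left hh.2 hα.le).trans hv
  rw [Measure.prod_apply hmeas, lintegral_smul_measure]
  simp_rw [hsection]
  rw [setLIntegral_congr_fun measurableSet_Icc hcdf, ← ofReal_integral_eq_lintegral_ofReal,
    integral_Icc_eq_integral_Ioc, ← intervalIntegral.integral_of_le hab.le,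
    integral_rayleigh_cdf_affine a b α β σ v hα hβ hσ, smul_eq_mul,
    ← ENNReal.ofReal_inv_of_pos hba, ← ENNReal.ofReal_mul (by positivity)]
  · congr 1
    field_simp
  · exact Continuous.integrableOn_Icc (by fun_prop)
  · refine Filter.Eventually.of_forall fun h => sub_nonneg.2 (Real.exp_le_one_iff.2 ?_)
    exact div_nonpos_of_nonpos_of_nonneg (neg_nonpos.2 (sq_nonneg _)) (by positivity)
end

section
/- Revenue equivalence identity between first-price and second-price sealed-bid auctions: for every v > v̲ with F(v) > 0, ∫_{v̲}^{v} t·(K−1)·f(t)·F(t)^(K−2) dt = v·F(v)^(K−1) − ∫_{v̲}^{v} F(t)^(K−1) dt; equivalently, b(v)·F(v)^(K−1) = ∫_{v̲}^{v} t·(K−1)·f(t)·F(t)^(K−2) dt, i.e. the equilibrium first-price bid times the winning probability equals the expected second-price payment (the expected maximum of the K−1 opponents' valuations restricted to being below v). -/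
open MeasureTheory intervalIntegral

/-- Revenue equivalence identity between first-price and second-price sealed-bid
auctions: for every `v > v̲` with `F v > 0`,
`∫_{v̲}^{v} t·(K-1)·f(t)·F(t)^(K-2) dt = v·F(v)^(K-1) - ∫_{v̲}^{v} F(t)^(K-1) dt`,
and equivalently `b(v)·F(v)^(K-1)` equals that expected second-price payment,
where `b` is the first-price equilibrium bid. -/
theorem fpsb_revenue_equivalence (K : ℕ) (hK : 2 ≤ K) (vlow : ℝ)
    (f F b : ℝ → ℝ) (hf_cont : Continuous f) (hf_nonneg : ∀ t, 0 ≤ f t)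
    (hF : ∀ v, F v = ∫ t in vlow..v, f t)
    (hb : ∀ v, b v = v - (∫ t in vlow..v, F t ^ (K - 1)) / F v ^ (K - 1)) :
    ∀ v : ℝ, vlow < v → 0 < F v →
      (∫ t in vlow..v, t * (K - 1) * f t * F t ^ (K - 2)) =
          v * F v ^ (K - 1) - ∫ t in vlow..v, F t ^ (K - 1) ∧
      b v * F v ^ (K - 1) =
        ∫ t in vlow..v, t * (K - 1) * f t * F t ^ (K - 2) := by
  intro v _ hv
  have hderiv : ∀ t, HasDerivAt F (f t) t := fun t => by
    rw [funext hF]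
    exact integral_hasDerivAt_right (hf_cont.intervalIntegrable _ _)
      (hf_cont.stronglyMeasurableAtFilter _ _) hf_cont.continuousAt
  have hF_cont : Continuous F :=
    continuous_iff_continuousAt.2 fun t => (hderiv t).continuousAt
  have hF_low : F vlow = 0 := by rw [hF, integral_same]
  have hpayment : (∫ t in vlow..v, t * (K - 1) * f t * F t ^ (K - 2)) =
      v * F v ^ (K - 1) - ∫ t in vlow..v, F t ^ (K - 1) := by
    obtain ⟨n, rfl⟩ := Nat.exists_eq_add_of_le' hK
    have hparts := integral_mul_deriv_eq_deriv_mul (a := vlow) (b := v)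
      (fun t _ => hasDerivAt_id' t) (fun t _ => (hderiv t).fun_pow (n + 1))
      (continuous_const.intervalIntegrable _ _)
      (Continuous.intervalIntegrable (by fun_prop) _ _)
    simp only [hF_low, one_mul, ne_eq, Nat.succ_ne_zero, not_false_eq_true, zero_pow, mul_zero,
      sub_zero, Nat.add_sub_cancel] at hparts
    rw [show n + 2 - 1 = n + 1 from rfl, Nat.add_sub_cancel, ← hparts]
    refine integral_congr fun t _ => ?_
    push_cast
    ring
  refine ⟨hpayment, ?_⟩
  rw [hpayment, hb, sub_mul, div_mul_cancel₀ _ (pow_pos hv _).ne']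
end

section
/- The equilibrium bidding function solves the first-order differential equation of the first-price sealed-bid auction: at every v > v̲ with F(v) > 0, b is differentiable and satisfies F(v)·b'(v) + (K−1)·f(v)·b(v) = v·(K−1)·f(v). -/
open MeasureTheory intervalIntegral

/-- The equilibrium bidding function of the first-price sealed-bid auction solves
the first-order ODE: at every `v > v̲` with `F v > 0`, `b` is differentiable and
`F(v)·b'(v) + (K-1)·f(v)·b(v) = v·(K-1)·f(v)`. -/
theorem fpsb_bid_solves_ode (K : ℕ) (hK : 2 ≤ K) (vlow : ℝ)
    (f F b : ℝ → ℝ) (hf_cont : Continuous f) (hf_nonneg : ∀ t, 0 ≤ f t)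
    (hF : ∀ v, F v = ∫ t in vlow..v, f t)
    (hb : ∀ v, b v = v - (∫ t in vlow..v, F t ^ (K - 1)) / F v ^ (K - 1)) :
    ∀ v : ℝ, vlow < v → 0 < F v →
      ∃ b' : ℝ, HasDerivAt b b' v ∧
        F v * b' + (K - 1) * f v * b v = v * (K - 1) * f v := by
  obtain ⟨n, rfl⟩ := Nat.exists_eq_add_of_le' hK
  intro v _ hv
  have hFd (x : ℝ) : HasDerivAt F (f x) x := by
    rw [funext hF]
    exact hf_cont.integral_hasStrictDerivAt vlow x |>.hasDerivAt
  have hFc : Continuous F := continuous_iff_continuousAt.2 fun x => (hFd x).continuousAt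
  have hI : HasDerivAt (fun x => ∫ t in vlow..x, F t ^ (n + 1)) (F v ^ (n + 1)) v :=
    (hFc.pow (n + 1)).integral_hasStrictDerivAt vlow v |>.hasDerivAt
  have hb' : b = fun x => x - (∫ t in vlow..x, F t ^ (n + 1)) / F x ^ (n + 1) := funext hb
  have hbd := (hasDerivAt_id' v).sub (hI.fun_div ((hFd v).fun_pow (n + 1)) (pow_pos hv _).ne')
  refine ⟨_, by rw [hb']; exact hbd, ?_⟩
  simp only [hb', Nat.add_sub_cancel]
  push_cast
  field_simp
  ring
end

section
/- Monotonicity of the equilibrium bid: for all v₁ ≤ v₂ with v̲ < v₁ and F(v₁) > 0, one has b(v₁) ≤ b(v₂); i.e. the first-price equilibrium bidding function is monotone nondecreasing on the set where F is positive. -/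
open MeasureTheory intervalIntegral

/-- For a nonnegative monotone `g`, the map `v ↦ v - (∫ t in a..v, g t) / g v` is monotone
where `g` is positive. -/
theorem sub_integral_div_le_of_monotoneOn {g : ℝ → ℝ} {a x y : ℝ}
    (hg : MonotoneOn g (Set.Ici a)) (hg0 : ∀ t, a ≤ t → 0 ≤ g t)
    (hax : a ≤ x) (hxy : x ≤ y) (hx : 0 < g x) :
    x - (∫ t in a..x, g t) / g x ≤ y - (∫ t in a..y, g t) / g y := by
  have hay : a ≤ y := hax.trans hxy
  have hgxy : g x ≤ g y := hg hax hay hxy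
  have hy : 0 < g y := hx.trans_le hgxy
  have hint : ∀ {u v : ℝ}, a ≤ u → a ≤ v → IntervalIntegrable g volume u v := fun hu hv =>
    (hg.mono fun _ ht => (le_inf hu hv).trans ht.1).intervalIntegrable
  have hsplit : (∫ t in a..y, g t) = (∫ t in a..x, g t) + ∫ t in x..y, g t :=
    (integral_add_adjacent_intervals (hint le_rfl hax) (hint hax hay)).symm
  have hnonneg : 0 ≤ ∫ t in a..x, g t := integral_nonneg hax fun t ht => hg0 t ht.1
  have hle : (∫ t in x..y, g t) ≤ (y - x) * g y := by
    have h := integral_mono_on hxy (hint hax hay) intervalIntegrable_const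
      fun t ht => hg (hax.trans ht.1) hay ht.2
    simpa using h
  have h₁ : (∫ t in a..x, g t) / g y ≤ (∫ t in a..x, g t) / g x :=
    div_le_div_of_nonneg_left hnonneg hx hgxy
  have h₂ : (∫ t in x..y, g t) / g y ≤ y - x := (div_le_iff₀ hy).2 hle
  rw [hsplit, add_div]
  linarith

/-- Monotonicity of the first-price equilibrium bid: for all `v₁ ≤ v₂` with
`v̲ < v₁` and `F v₁ > 0`, one has `b v₁ ≤ b v₂`. -/
theorem fpsb_bid_monotone (K : ℕ) (hK : 2 ≤ K) (vlow : ℝ)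
    (f F b : ℝ → ℝ) (hf_cont : Continuous f) (hf_nonneg : ∀ t, 0 ≤ f t)
    (hF : ∀ v, F v = ∫ t in vlow..v, f t)
    (hb : ∀ v, b v = v - (∫ t in vlow..v, F t ^ (K - 1)) / F v ^ (K - 1)) :
    ∀ v₁ v₂ : ℝ, v₁ ≤ v₂ → vlow < v₁ → 0 < F v₁ → b v₁ ≤ b v₂ := by
  intro v₁ v₂ h₁₂ hv₁ hF₁
  have hmono : Monotone F := fun x y hxy => by
    have h := integral_interval_sub_left (hf_cont.intervalIntegrable (μ := volume) vlow y)
      (hf_cont.intervalIntegrable vlow x)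
    have hxy_nonneg : 0 ≤ ∫ t in x..y, f t := integral_nonneg hxy fun t _ => hf_nonneg t
    rw [hF x, hF y]
    linarith
  have hF_nonneg : ∀ t, vlow ≤ t → 0 ≤ F t := fun t ht => by
    rw [hF t]
    exact integral_nonneg ht fun s _ => hf_nonneg s
  rw [hb v₁, hb v₂]
  exact sub_integral_div_le_of_monotoneOn (g := fun t => F t ^ (K - 1))
    (fun x hx y _ hxy => pow_le_pow_left₀ (hF_nonneg x hx) (hmono hxy) _)
    (fun t ht => pow_nonneg (hF_nonneg t ht) _) hv₁.le h₁₂ (pow_pos hF₁ _)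
end
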